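/- Let X = (X_t)_{t∈[0,1]} be a centered Gaussian process with almost surely continuous sample paths satisfying ‖X_t − X_s‖₂ ≤ C|t−s|^H for all t, s ∈ [0,1], with constants C > 0 and H ∈ [1/2, 1). Then E[max_{0≤t≤1} X_t] ≤ C · E[max_{0≤t≤1} W_t], where W = (W_t)_{t∈[0,1]} is any standard Brownian motion, i.e. a centered Gaussian process with almost surely continuous sample paths and covariance E[W_s W_t] = min(s,t). -/

import Mathlib

open MeasureTheory ProbabilityTheory Real Set Filter Topology

noncomputable section

/-- `X` is a centered Gaussian process on the time set `S`: every finite linear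
combination `∑ i, c i * X (ts i)` of its values at times in `S` is a centered
Gaussian random variable. -/
def IsCenteredGaussianOn {Ω : Type} [MeasurableSpace Ω] (μ : Measure Ω)
    (X : ℝ → Ω → ℝ) (S : Set ℝ) : Prop :=
  (∀ t ∈ S, Measurable (X t)) ∧
  ∀ (k : ℕ) (c : Fin k → ℝ) (ts : Fin k → ℝ), (∀ i, ts i ∈ S) →
    ∃ v : NNReal, μ.map (fun ω => ∑ i, c i * X (ts i) ω) = gaussianReal 0 v

/-- The `L²`-norm `‖Y‖₂ = (E Y²)^{1/2}` of a real random variable. -/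
def l2norm {Ω : Type} [MeasurableSpace Ω] (μ : Measure Ω) (Y : Ω → ℝ) : ℝ :=
  Real.sqrt (∫ ω, (Y ω) ^ 2 ∂μ)

/-- The expected supremum `E [sup_{0 ≤ t ≤ 1} X_t]`. -/
def expMax {Ω : Type} [MeasurableSpace Ω] (μ : Measure Ω) (X : ℝ → Ω → ℝ) : ℝ :=
  ∫ ω, (⨆ t : Icc (0:ℝ) 1, X t.1 ω) ∂μ

/-- The expected maximum over the grid: `E [max_{0 ≤ i ≤ n} X_{i/n}]`. -/
def expMaxGrid {Ω : Type} [MeasurableSpace Ω] (μ : Measure Ω) (X : ℝ → Ω → ℝ) (n : ℕ) : ℝ :=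
  ∫ ω, (⨆ i : Fin (n + 1), X (((i : ℕ) : ℝ) / (n : ℝ)) ω) ∂μ

/-- `B` is a fractional Brownian motion with Hurst parameter `H`: a centered Gaussian
process on `[0,∞)` with a.s. continuous sample paths, `B 0 = 0`, and covariance
`E[B_s B_t] = (s^{2H} + t^{2H} - |t-s|^{2H}) / 2`. -/
def IsFBM {Ω : Type} [MeasurableSpace Ω] (μ : Measure Ω) (H : ℝ) (B : ℝ → Ω → ℝ) : Prop :=
  IsCenteredGaussianOn μ B (Ici 0) ∧
  (∀ᵐ ω ∂μ, ContinuousOn (fun t => B t ω) (Ici 0)) ∧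
  (∀ᵐ ω ∂μ, B 0 ω = 0) ∧
  ∀ s t : ℝ, 0 ≤ s → 0 ≤ t →
    ∫ ω, B s ω * B t ω ∂μ = (s ^ (2 * H) + t ^ (2 * H) - |t - s| ^ (2 * H)) / 2

/-- Integrability against a nondegenerate Gaussian measure, expressed with its density. -/
theorem integrable_gaussianReal_iff {m : ℝ} {v : NNReal} (hv : v ≠ 0) {f : ℝ → ℝ} :
    Integrable f (gaussianReal m v) ↔ Integrable (fun x => gaussianPDFReal m v x * f x) := by
  rw [gaussianReal_of_var_ne_zero m hv,
    integrable_withDensity_iff_integrable_smul' (measurable_gaussianPDF m v)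
      (ae_of_all _ fun x => gaussianPDF_lt_top)]
  simp only [toReal_gaussianPDF, smul_eq_mul]

theorem hasDerivAt_gaussianPDFReal_zero (v : NNReal) (x : ℝ) :
    HasDerivAt (gaussianPDFReal 0 v) (-(x / v) * gaussianPDFReal 0 v x) x := by
  have h : HasDerivAt (fun y : ℝ => -(y - 0) ^ 2 / (2 * (v : ℝ))) (-(x / v)) x := by
    have := ((((hasDerivAt_id x).sub_const 0).pow 2).neg).div_const (2 * (v : ℝ))
    convert! this using 1
    norm_num
    ring
  have := (h.exp).const_mul ((√(2 * π * v))⁻¹)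
  rw [gaussianPDFReal_def]
  convert! this using 1
  ring

/-- **Stein's identity** for a centered real Gaussian measure. -/
theorem integral_id_mul_gaussianReal {v : NNReal} {h h' : ℝ → ℝ} {A B : ℝ}
    (hd : ∀ x, HasDerivAt h (h' x) x) (hA : ∀ x, |h x| ≤ A) (hB : ∀ x, |h' x| ≤ B)
    (hm : Measurable h') :
    ∫ x, x * h x ∂(gaussianReal 0 v) = v * ∫ x, h' x ∂(gaussianReal 0 v) := by
  rcases eq_or_ne v 0 with rfl | hv
  · simp [gaussianReal_zero_var]
  have hv' : (v : ℝ) ≠ 0 := by exact_mod_cast hv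
  have hmh : Measurable h := (continuous_iff_continuousAt.2 fun x => (hd x).continuousAt).measurable
  have hid : Integrable (fun x : ℝ => x) (gaussianReal 0 v) :=
    (memLp_id_gaussianReal 1).integrable le_rfl
  have i1 : Integrable (fun x => x * h x) (gaussianReal 0 v) :=
    hid.mul_bdd (c := A) hmh.aestronglyMeasurable (ae_of_all _ hA)
  have i2 : Integrable h (gaussianReal 0 v) :=
    Integrable.of_bound hmh.aestronglyMeasurable A (ae_of_all _ hA)
  have i3 : Integrable h' (gaussianReal 0 v) :=
    Integrable.of_bound hm.aestronglyMeasurable B (ae_of_all _ hB)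
  rw [integrable_gaussianReal_iff hv] at i1 i2 i3
  have key := integral_mul_deriv_eq_deriv_mul_of_integrable (u := h) (u' := h')
    (v := gaussianPDFReal 0 v) (v' := fun x => -(x / v) * gaussianPDFReal 0 v x)
    (fun x _ => hd x) (fun x _ => hasDerivAt_gaussianPDFReal_zero v x)
    ((i1.const_mul (-(v : ℝ)⁻¹)).congr (ae_of_all _ fun x => by simp; ring))
    (i3.congr (ae_of_all _ fun x => by simp [mul_comm]))
    (i2.congr (ae_of_all _ fun x => by simp [mul_comm]))
  rw [integral_gaussianReal_eq_integral_smul hv, integral_gaussianReal_eq_integral_smul hv]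
  have e1 : ∫ x, h x * (-(x / v) * gaussianPDFReal 0 v x)
      = -(v : ℝ)⁻¹ * ∫ x, gaussianPDFReal 0 v x • (x * h x) := by
    rw [← integral_const_mul]
    congr 1; ext x; simp; ring
  have e2 : ∫ x, h' x * gaussianPDFReal 0 v x = ∫ x, gaussianPDFReal 0 v x • h' x := by
    congr 1; ext x; simp [mul_comm]
  rw [e1, e2] at key
  field_simp at key
  linarith

/-- **Gaussian integration by parts**: if `(U, V)` is a jointly Gaussian vector with `U` centered,
then `E[U g(V)] = ∑ j, Cov(U, V_j) E[∂_j g(V)]`. -/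
theorem ProbabilityTheory.HasGaussianLaw.integral_mul_comp_eq_sum {Ω : Type*} [MeasurableSpace Ω] {P : Measure Ω}
    {ι : Type*} [Fintype ι] {U : Ω → ℝ} {V : Ω → ι → ℝ} {g : (ι → ℝ) → ℝ}
    {g' : ι → (ι → ℝ) → ℝ} {A B : ℝ}
    (hUV : HasGaussianLaw (fun ω => (U ω, V ω)) P) (hU0 : ∫ ω, U ω ∂P = 0)
    (hg : ∀ (x a : ι → ℝ) (s : ℝ), HasDerivAt (fun s : ℝ => g (x + s • a))
      (∑ j, a j * g' j (x + s • a)) s)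
    (hA : ∀ x, |g x| ≤ A) (hB : ∀ j x, |g' j x| ≤ B) (hgm : Measurable g)
    (hgm' : ∀ j, Measurable (g' j)) :
    ∫ ω, U ω * g (V ω) ∂P = ∑ j, cov[U, fun ω => V ω j; P] * ∫ ω, g' j (V ω) ∂P := by
  have := hUV.isProbabilityMeasure
  have hU : HasGaussianLaw U P := hUV.fst
  have hV : HasGaussianLaw V P := hUV.snd
  have hVj : ∀ j, HasGaussianLaw (fun ω => V ω j) P := fun j => hV.eval j
  have hlaw := hU.map_eq_gaussianReal
  rw [hU0] at hlaw
  set v : NNReal := Var[U; P].toNNReal with hv_def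
  have hv : (v : ℝ) = Var[U; P] := Real.coe_toNNReal _ (variance_nonneg _ _)
  set c : ι → ℝ := fun j => cov[U, fun ω => V ω j; P] with hc
  set a : ι → ℝ := fun j => c j / v with ha
  have hva : ∀ j, v * a j = c j := by
    intro j
    rcases eq_or_ne (v : ℝ) 0 with h0 | h0
    · have hU_ae : U =ᵐ[P] 0 := by
        have := (evariance_eq_zero_iff hU.aemeasurable).1
          (by rw [← hU.memLp_two.ofReal_variance_eq, ← hv, h0, ENNReal.ofReal_zero])
        filter_upwards [this] with ω hω
        simpa [hU0] using hω
      have : c j = 0 := by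
        simp only [hc]
        rw [covariance_eq_sub hU.memLp_two (hVj j).memLp_two]
        rw [integral_congr_ae (g := fun _ => (0:ℝ)), hU0]
        · simp
        · filter_upwards [hU_ae] with ω hω
          simp [hω]
      simp [this, h0]
    · simp only [ha]; field_simp
  set R : Ω → ι → ℝ := fun ω => V ω - U ω • a with hR
  have hUR : HasGaussianLaw (fun ω => (U ω, R ω)) P := by
    have := hUV.map_fun (((ContinuousLinearMap.fst ℝ ℝ (ι → ℝ))).prod
      (ContinuousLinearMap.snd ℝ ℝ (ι → ℝ) -
        (ContinuousLinearMap.fst ℝ ℝ (ι → ℝ)).smulRight a))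
    simpa using this
  have hUR' : HasGaussianLaw (fun ω => ((fun _ : Unit => U ω), R ω)) P := by
    have := hUR.map_fun ((ContinuousLinearMap.pi
      (fun _ : Unit => ContinuousLinearMap.fst ℝ ℝ (ι → ℝ))).prod
      (ContinuousLinearMap.snd ℝ ℝ (ι → ℝ)))
    simpa using this
  have hind : IndepFun U R P := by
    have := HasGaussianLaw.indepFun_of_covariance_eval
      (X := fun (_ : Unit) ω => U ω) (Y := fun j ω => R ω j) hUR' (by
        intro _ j
        have : (fun ω => R ω j) = (fun ω => V ω j) - fun ω => U ω * a j := by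
          ext ω; simp [hR]
        rw [this, covariance_sub_right hU.memLp_two (hVj j).memLp_two
          (hU.memLp_two.mul_const _), covariance_mul_const_right, covariance_self
          hU.aemeasurable, ← hv, hva j]
        simp [hc])
    exact this.comp (measurable_pi_apply ()) measurable_id
  have hVR : ∀ ω, V ω = R ω + U ω • a := fun ω => by simp [hR]
  have hRm : AEMeasurable R P := hUR.snd.aemeasurable
  have hprod := (indepFun_iff_map_prod_eq_prod_map_map hU.aemeasurable hRm).1 hind
  have hpm : AEMeasurable (fun ω => (U ω, R ω)) P := hUR.aemeasurable
  have : IsProbabilityMeasure (P.map R) := Measure.isProbabilityMeasure_map hRm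
  have hmeas : Measurable (fun z : ℝ × (ι → ℝ) => z.2 + z.1 • a) := by fun_prop
  have change : ∀ F : ℝ × (ι → ℝ) → ℝ, Measurable F →
      Integrable F ((gaussianReal 0 v).prod (P.map R)) →
      ∫ ω, F (U ω, R ω) ∂P = ∫ r, ∫ u, F (u, r) ∂(gaussianReal 0 v) ∂(P.map R) := by
    intro F hF hFi
    rw [← integral_map (f := F) hpm hF.aestronglyMeasurable, hprod, hlaw,
      integral_prod_symm _ hFi]
  have hid : Integrable (fun x : ℝ => x) (gaussianReal 0 v) :=
    (memLp_id_gaussianReal 1).integrable le_rfl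
  have ibp : ∀ r, ∫ u, u * g (r + u • a) ∂(gaussianReal 0 v)
      = ∑ j, c j * ∫ u, g' j (r + u • a) ∂(gaussianReal 0 v) := by
    intro r
    have hm : Measurable (fun u : ℝ => r + u • a) := by fun_prop
    have hi : ∀ j, Integrable (fun u : ℝ => g' j (r + u • a)) (gaussianReal 0 v) := fun j =>
      Integrable.of_bound ((hgm' j).comp hm).aestronglyMeasurable B (ae_of_all _ fun _ => hB _ _)
    rw [integral_id_mul_gaussianReal (hg r a) (fun _ => hA _) (B := ∑ j, |a j| * B)
      (fun x => (Finset.abs_sum_le_sum_abs _ _).trans (Finset.sum_le_sum fun j _ => by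
        rw [abs_mul]; exact mul_le_mul_of_nonneg_left (hB _ _) (abs_nonneg _)))
      (Finset.measurable_sum _ fun j _ => ((hgm' j).comp hm).const_mul _),
      integral_finsetSum _ (fun j _ => (hi j).const_mul _), Finset.mul_sum]
    refine Finset.sum_congr rfl fun j _ => ?_
    rw [integral_const_mul, ← mul_assoc, hva]
  calc ∫ ω, U ω * g (V ω) ∂P
      = ∫ ω, (fun z : ℝ × (ι → ℝ) => z.1 * g (z.2 + z.1 • a)) (U ω, R ω) ∂P := by
        simp only [← hVR]
    _ = ∫ r, ∫ u, u * g (r + u • a) ∂(gaussianReal 0 v) ∂(P.map R) :=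
        change _ (measurable_fst.mul (hgm.comp hmeas))
          ((hid.comp_fst _).mul_bdd (c := A) (hgm.comp hmeas).aestronglyMeasurable
            (ae_of_all _ fun _ => hA _))
    _ = ∑ j, c j * ∫ r, ∫ u, g' j (r + u • a) ∂(gaussianReal 0 v) ∂(P.map R) := by
        simp_rw [ibp]
        rw [integral_finsetSum]
        · simp_rw [integral_const_mul]
        · intro j _
          have : Integrable (fun z : ℝ × (ι → ℝ) => g' j (z.2 + z.1 • a))
              ((gaussianReal 0 v).prod (P.map R)) :=
            Integrable.of_bound ((hgm' j).comp hmeas).aestronglyMeasurable B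
              (ae_of_all _ fun _ => hB _ _)
          exact this.integral_prod_right.const_mul _
    _ = ∑ j, c j * ∫ ω, g' j (V ω) ∂P := by
        refine Finset.sum_congr rfl fun j _ => ?_
        rw [← change (fun z => g' j (z.2 + z.1 • a)) ((hgm' j).comp hmeas)
          (Integrable.of_bound ((hgm' j).comp hmeas).aestronglyMeasurable B
              (ae_of_all _ fun _ => hB _ _))]
        simp only [← hVR]

section Softmax

variable {ι : Type*} [Fintype ι]

/-- The smooth approximation `log ∑ exp x_i` of the maximum. -/
def logSumExp (x : ι → ℝ) : ℝ := Real.log (∑ i, Real.exp (x i))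

/-- The softmax weights `exp x_i / ∑ exp x_j`, the partial derivatives of `logSumExp`. -/
def softmax (i : ι) (x : ι → ℝ) : ℝ := Real.exp (x i) / ∑ j, Real.exp (x j)

theorem sum_exp_pos [Nonempty ι] (x : ι → ℝ) : 0 < ∑ i, Real.exp (x i) :=
  Finset.sum_pos (fun _ _ => Real.exp_pos _) Finset.univ_nonempty

theorem softmax_nonneg (i : ι) (x : ι → ℝ) : 0 ≤ softmax i x :=
  div_nonneg (Real.exp_pos _).le (Finset.sum_nonneg fun _ _ => (Real.exp_pos _).le)

theorem sum_softmax [Nonempty ι] (x : ι → ℝ) : ∑ i, softmax i x = 1 := by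
  simp only [softmax, ← Finset.sum_div]
  exact div_self (sum_exp_pos x).ne'

theorem softmax_le_one [Nonempty ι] (i : ι) (x : ι → ℝ) : softmax i x ≤ 1 := by
  rw [← sum_softmax x]
  exact Finset.single_le_sum (fun j _ => softmax_nonneg j x) (Finset.mem_univ i)

@[fun_prop]
theorem measurable_softmax (i : ι) : Measurable (softmax i) := by
  unfold softmax; fun_prop

@[fun_prop]
theorem measurable_logSumExp : Measurable (logSumExp (ι := ι)) := by
  unfold logSumExp; fun_prop

theorem hasDerivAt_logSumExp_comp [Nonempty ι] {z : ℝ → ι → ℝ} {w : ι → ℝ} {t : ℝ}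
    (hz : ∀ i, HasDerivAt (fun s => z s i) (w i) t) :
    HasDerivAt (fun s => logSumExp (z s)) (∑ i, w i * softmax i (z t)) t := by
  have h := (HasDerivAt.fun_sum (u := Finset.univ) fun i _ => (hz i).exp).log (sum_exp_pos (z t)).ne'
  convert! h using 1
  rw [Finset.sum_div]
  exact Finset.sum_congr rfl fun i _ => by simp only [softmax]; ring

theorem hasDerivAt_softmax_comp [DecidableEq ι] [Nonempty ι] {z : ℝ → ι → ℝ} {w : ι → ℝ} {t : ℝ}
    (hz : ∀ i, HasDerivAt (fun s => z s i) (w i) t) (i : ι) :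
    HasDerivAt (fun s => softmax i (z s))
      (∑ j, w j * (softmax i (z t) * ((if j = i then 1 else 0) - softmax j (z t)))) t := by
  have hS := (sum_exp_pos (z t)).ne'
  have h := (hz i).exp.div (HasDerivAt.fun_sum (u := Finset.univ) fun i _ => (hz i).exp) hS
  convert! h using 1
  have e : ∑ j, w j * (softmax i (z t) * ((if j = i then 1 else 0) - softmax j (z t)))
      = softmax i (z t) * (w i - ∑ j, w j * softmax j (z t)) := by
    rw [mul_sub, Finset.mul_sum]
    simp only [mul_sub, Finset.sum_sub_distrib]
    congr 1
    · simp [mul_comm]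
    · exact Finset.sum_congr rfl fun j _ => by ring
  have e2 : ∑ j, w j * softmax j (z t)
      = (∑ j, Real.exp (z t j) * w j) / ∑ j, Real.exp (z t j) := by
    rw [Finset.sum_div]
    exact Finset.sum_congr rfl fun j _ => by simp only [softmax]; ring
  rw [e, e2, softmax]
  field_simp

theorem le_logSumExp (x : ι → ℝ) (i : ι) : x i ≤ logSumExp x := by
  have : Nonempty ι := ⟨i⟩
  rw [logSumExp, Real.le_log_iff_exp_le (sum_exp_pos x)]
  exact Finset.single_le_sum (f := fun j => Real.exp (x j)) (fun j _ => (Real.exp_pos _).le)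
    (Finset.mem_univ i)

theorem logSumExp_le [Nonempty ι] {x : ι → ℝ} {M : ℝ} (h : ∀ i, x i ≤ M) :
    logSumExp x ≤ M + Real.log (Fintype.card ι) := by
  have hc : (0 : ℝ) < Fintype.card ι := by exact_mod_cast Fintype.card_pos
  rw [logSumExp, Real.log_le_iff_le_exp (sum_exp_pos x), Real.exp_add, Real.exp_log hc]
  calc ∑ i, Real.exp (x i) ≤ ∑ _i : ι, Real.exp M :=
        Finset.sum_le_sum fun i _ => Real.exp_le_exp.2 (h i)
    _ = _ := by simp [mul_comm]

theorem abs_logSumExp_le [Nonempty ι] (x : ι → ℝ) :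
    |logSumExp x| ≤ ∑ i, |x i| + Real.log (Fintype.card ι) := by
  have h1 : ∀ i, |x i| ≤ ∑ j, |x j| := fun i =>
    Finset.single_le_sum (f := fun j => |x j|) (fun j _ => abs_nonneg _) (Finset.mem_univ i)
  have hlog : 0 ≤ Real.log (Fintype.card ι) :=
    Real.log_nonneg (by exact_mod_cast Fintype.card_pos)
  rw [abs_le]
  constructor
  · let i := Classical.arbitrary ι
    linarith [le_logSumExp x i, h1 i, neg_abs_le (x i)]
  · exact logSumExp_le fun i => (le_abs_self _).trans (h1 i)

/-- The quadratic form controlling the derivative of Gaussian interpolation. -/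
theorem sum_sum_mul_softmax_nonneg [DecidableEq ι] {p : ι → ℝ} (hp : ∀ i, 0 ≤ p i)
    (hp1 : ∑ i, p i = 1) {D : ι → ι → ℝ} (hD : ∀ i j, 0 ≤ D i i + D j j - 2 * D i j) :
    0 ≤ ∑ i, ∑ j, D i j * (p i * ((if j = i then 1 else 0) - p j)) := by
  have e1 : ∑ i, ∑ j, D i j * (p i * ((if j = i then 1 else 0) - p j))
      = ∑ i, D i i * p i - ∑ i, ∑ j, D i j * (p i * p j) := by
    rw [← Finset.sum_sub_distrib]
    refine Finset.sum_congr rfl fun i _ => ?_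
    simp only [mul_sub, Finset.sum_sub_distrib]
    simp
  have e2 : ∑ i, ∑ j, p i * p j * D i i = ∑ i, D i i * p i := by
    refine Finset.sum_congr rfl fun i _ => ?_
    rw [← Finset.sum_mul, ← Finset.mul_sum, hp1]; ring
  have e3 : ∑ i, ∑ j, p i * p j * D j j = ∑ i, D i i * p i := by
    rw [Finset.sum_comm]
    refine Finset.sum_congr rfl fun i _ => ?_
    rw [← Finset.sum_mul, ← Finset.sum_mul, hp1]; ring
  have e4 : ∑ i, ∑ j, p i * p j * (D i i + D j j - 2 * D i j)
      = 2 * (∑ i, D i i * p i - ∑ i, ∑ j, D i j * (p i * p j)) := by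
    simp only [mul_sub, mul_add, Finset.sum_sub_distrib, Finset.sum_add_distrib, e2, e3]
    rw [two_mul, Finset.mul_sum]
    congr 1
    refine Finset.sum_congr rfl fun i _ => ?_
    rw [Finset.mul_sum]
    exact Finset.sum_congr rfl fun j _ => by ring
  have : 0 ≤ ∑ i, ∑ j, p i * p j * (D i i + D j j - 2 * D i j) :=
    Finset.sum_nonneg fun i _ => Finset.sum_nonneg fun j _ =>
      mul_nonneg (mul_nonneg (hp i) (hp j)) (hD i j)
  rw [e1]; linarith

end Softmax

section SudakovFernique

variable {Ω : Type*} [MeasurableSpace Ω] {P : Measure Ω} {ι : Type*} [Fintype ι]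

theorem ProbabilityTheory.HasGaussianLaw.integrable_logSumExp [Nonempty ι] {X : Ω → ι → ℝ}
    (hX : HasGaussianLaw X P) : Integrable (fun ω => logSumExp (X ω)) P := by
  have := hX.isProbabilityMeasure
  refine Integrable.mono' (g := fun ω => ∑ i, |X ω i| + Real.log (Fintype.card ι))
    ((integrable_finsetSum _ fun i _ => (hX.eval i).integrable.abs).add (integrable_const _))
    (measurable_logSumExp.comp_aemeasurable hX.aemeasurable).aestronglyMeasurable
    (ae_of_all _ fun ω => abs_logSumExp_le _)

theorem ProbabilityTheory.HasGaussianLaw.integrable_iSup [Nonempty ι] {X : Ω → ι → ℝ}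
    (hX : HasGaussianLaw X P) : Integrable (fun ω => ⨆ i, X ω i) P := by
  refine Integrable.mono' (g := fun ω => ∑ i, |X ω i|)
    (integrable_finsetSum _ fun i _ => (hX.eval i).integrable.abs)
    (AEMeasurable.iSup fun i => (hX.eval i).aemeasurable).aestronglyMeasurable
    (ae_of_all _ fun ω => ?_)
  have h1 : ∀ i, |X ω i| ≤ ∑ j, |X ω j| := fun i =>
    Finset.single_le_sum (f := fun j => |X ω j|) (fun j _ => abs_nonneg _) (Finset.mem_univ i)
  rw [Real.norm_eq_abs, abs_le]
  constructor
  · let i := Classical.arbitrary ι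
    have : X ω i ≤ ⨆ j, X ω j := le_ciSup (Finite.bddAbove_range _) i
    linarith [h1 i, neg_abs_le (X ω i)]
  · exact ciSup_le fun i => (le_abs_self _).trans (h1 i)

/-- Gaussian interpolation: comparison of `E log ∑ exp` for independent centered Gaussian vectors
whose increments are ordered in `L²`. -/
theorem integral_logSumExp_le_of_indepFun [Nonempty ι] {X Y : Ω → ι → ℝ}
    (hX : HasGaussianLaw X P) (hY : HasGaussianLaw Y P) (hXY : IndepFun X Y P)
    (hX0 : ∀ i, ∫ ω, X ω i ∂P = 0) (hY0 : ∀ i, ∫ ω, Y ω i ∂P = 0)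
    (hinc : ∀ i j, Var[fun ω => X ω i - X ω j; P] ≤ Var[fun ω => Y ω i - Y ω j; P]) :
    ∫ ω, logSumExp (X ω) ∂P ≤ ∫ ω, logSumExp (Y ω) ∂P := by
  classical
  have := hX.isProbabilityMeasure
  have hXi : ∀ i, HasGaussianLaw (fun ω => X ω i) P := fun i => hX.eval i
  have hYi : ∀ i, HasGaussianLaw (fun ω => Y ω i) P := fun i => hY.eval i
  have hJ : HasGaussianLaw (fun ω => (X ω, Y ω)) P := hXY.hasGaussianLaw hX hY
  have hcross : ∀ i j, cov[fun ω => X ω i, fun ω => Y ω j; P] = 0 := fun i j =>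
    (hXY.comp (measurable_pi_apply i) (measurable_pi_apply j)).covariance_eq_zero
      (hXi i).memLp_two (hYi j).memLp_two
  let Z : ℝ → Ω → ι → ℝ := fun t ω => Real.cos t • X ω + Real.sin t • Y ω
  let Z' : ℝ → Ω → ι → ℝ := fun t ω => (-Real.sin t) • X ω + Real.cos t • Y ω
  have hJZ : ∀ t i, HasGaussianLaw (fun ω => (Z' t ω i, Z t ω)) P := by
    intro t i
    let F := ContinuousLinearMap.fst ℝ (ι → ℝ) (ι → ℝ)
    let S := ContinuousLinearMap.snd ℝ (ι → ℝ) (ι → ℝ)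
    exact hJ.map_fun (((ContinuousLinearMap.proj (R := ℝ) (φ := fun _ : ι => ℝ) i).comp
      ((-Real.sin t) • F + Real.cos t • S)).prod (Real.cos t • F + Real.sin t • S))
  let D : ι → ι → ℝ := fun i j =>
    cov[fun ω => Y ω i, fun ω => Y ω j; P] - cov[fun ω => X ω i, fun ω => X ω j; P]
  have hD : ∀ i j, 0 ≤ D i i + D j j - 2 * D i j := by
    intro i j
    have h := hinc i j
    rw [variance_fun_sub (hXi i).memLp_two (hXi j).memLp_two,
      variance_fun_sub (hYi i).memLp_two (hYi j).memLp_two] at h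
    simp only [D, covariance_self (hXi _).aemeasurable, covariance_self (hYi _).aemeasurable]
    linarith
  have hcov : ∀ t i j, cov[fun ω => Z' t ω i, fun ω => Z t ω j; P]
      = Real.sin t * Real.cos t * D i j := by
    intro t i j
    have e1 : (fun ω => Z' t ω i)
        = (-Real.sin t) • (fun ω => X ω i) + Real.cos t • fun ω => Y ω i := by
      ext ω; simp [Z']
    have e2 : (fun ω => Z t ω j)
        = Real.cos t • (fun ω => X ω j) + Real.sin t • fun ω => Y ω j := by
      ext ω; simp [Z]
    have hx := fun k (c : ℝ) => (hXi k).memLp_two.const_smul c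
    have hy := fun k (c : ℝ) => (hYi k).memLp_two.const_smul c
    rw [e1, e2, covariance_add_left (hx _ _) (hy _ _) ((hx _ _).add (hy _ _)),
      covariance_add_right (hx _ _) (hx _ _) (hy _ _),
      covariance_add_right (hy _ _) (hx _ _) (hy _ _)]
    simp only [covariance_smul_left, covariance_smul_right, hcross,
      covariance_comm (fun ω => Y ω i) (fun ω => X ω j), D]
    ring
  have hZd : ∀ ω t i, HasDerivAt (fun s => Z s ω i) (Z' t ω i) t := by
    intro ω t i
    have := ((Real.hasDerivAt_cos t).mul_const (X ω i)).add
      ((Real.hasDerivAt_sin t).mul_const (Y ω i))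
    convert! this using 1
  have hZ'0 : ∀ t i, ∫ ω, Z' t ω i ∂P = 0 := by
    intro t i
    simp only [Z', Pi.add_apply, Pi.smul_apply, smul_eq_mul]
    rw [integral_add ((hXi i).integrable.const_mul _) ((hYi i).integrable.const_mul _),
      integral_const_mul, integral_const_mul, hX0, hY0]
    simp
  have hderiv : ∀ t, HasDerivAt (fun t => ∫ ω, logSumExp (Z t ω) ∂P)
      (∫ ω, ∑ i, Z' t ω i * softmax i (Z t ω) ∂P) t := by
    intro t
    have hZm : ∀ t, AEMeasurable (Z t) P := fun t => (hJZ t (Classical.arbitrary ι)).snd.aemeasurable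
    refine (hasDerivAt_integral_of_dominated_loc_of_deriv_le (s := univ)
      (bound := fun ω => ∑ i, (|X ω i| + |Y ω i|)) univ_mem
      (Eventually.of_forall fun s => (hJZ s (Classical.arbitrary ι)).snd.integrable_logSumExp.1)
      (hJZ t (Classical.arbitrary ι)).snd.integrable_logSumExp ?_
      (ae_of_all _ fun ω s _ => ?_)
      (integrable_finsetSum _ fun i _ => (hXi i).integrable.abs.add (hYi i).integrable.abs)
      (ae_of_all _ fun ω s _ => hasDerivAt_logSumExp_comp (hZd ω s))).2
    · refine (Finset.aemeasurable_fun_sum _ fun i _ =>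
        (hJZ t i).fst.aemeasurable.mul
          ((measurable_softmax i).comp_aemeasurable (hZm t))).aestronglyMeasurable
    · rw [Real.norm_eq_abs]
      refine (Finset.abs_sum_le_sum_abs _ _).trans (Finset.sum_le_sum fun i _ => ?_)
      have h1 : |softmax i (Z s ω)| ≤ 1 := by
        rw [abs_of_nonneg (softmax_nonneg _ _)]; exact softmax_le_one _ _
      have h2 : |Z' s ω i| ≤ |X ω i| + |Y ω i| := by
        refine (abs_add_le _ _).trans (add_le_add ?_ ?_)
        · simp only [Pi.smul_apply, smul_eq_mul, abs_mul, abs_neg]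
          exact mul_le_of_le_one_left (abs_nonneg _) (Real.abs_sin_le_one s)
        · simp only [Pi.smul_apply, smul_eq_mul, abs_mul]
          exact mul_le_of_le_one_left (abs_nonneg _) (Real.abs_cos_le_one s)
      rw [abs_mul]
      exact (mul_le_of_le_one_right (abs_nonneg _) h1).trans h2
  have hpos : ∀ t ∈ Icc 0 (π / 2), 0 ≤ ∫ ω, ∑ i, Z' t ω i * softmax i (Z t ω) ∂P := by
    intro t ht
    have hsm : ∀ i (x : ι → ℝ), |softmax i x| ≤ 1 := fun i x => by
      rw [abs_of_nonneg (softmax_nonneg _ _)]; exact softmax_le_one _ _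
    have hsm' : ∀ i j (x : ι → ℝ), |softmax i x * ((if j = i then 1 else 0) - softmax j x)| ≤ 1 := by
      intro i j x
      rw [abs_mul]
      refine mul_le_one₀ (hsm i x) (abs_nonneg _) ?_
      have h0 := softmax_nonneg j x
      have h1 := softmax_le_one j x
      rw [abs_le]
      split_ifs <;> constructor <;> linarith
    have hm' : ∀ i j, Measurable fun x : ι → ℝ =>
        softmax i x * ((if j = i then 1 else 0) - softmax j x) := by
      intro i j; fun_prop
    have hZm : AEMeasurable (Z t) P := (hJZ t (Classical.arbitrary ι)).snd.aemeasurable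
    have hint : ∀ i j, Integrable (fun ω => softmax i (Z t ω) *
        ((if j = i then 1 else 0) - softmax j (Z t ω))) P := fun i j =>
      Integrable.of_bound ((hm' i j).comp_aemeasurable hZm).aestronglyMeasurable 1
        (ae_of_all _ fun ω => hsm' i j _)
    have hibp : ∀ i, ∫ ω, Z' t ω i * softmax i (Z t ω) ∂P = ∑ j, Real.sin t * Real.cos t * D i j *
        ∫ ω, softmax i (Z t ω) * ((if j = i then 1 else 0) - softmax j (Z t ω)) ∂P := by
      intro i
      rw [HasGaussianLaw.integral_mul_comp_eq_sum (g := softmax i)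
        (g' := fun j x => softmax i x * ((if j = i then 1 else 0) - softmax j x))
        (hJZ t i) (hZ'0 t i) ?_ (hsm i) (hsm' i) (measurable_softmax i) (hm' i)]
      · simp_rw [hcov]
      · intro x a s
        exact hasDerivAt_softmax_comp (z := fun s => x + s • a)
          (fun k => by simpa using ((hasDerivAt_id s).mul_const (a k)).const_add (x k)) i
    have hint' : ∀ i, Integrable (fun ω => Z' t ω i * softmax i (Z t ω)) P := fun i =>
      (hJZ t i).fst.integrable.mul_bdd (c := 1)
        ((measurable_softmax i).comp_aemeasurable hZm).aestronglyMeasurable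
        (ae_of_all _ fun ω => hsm i _)
    rw [integral_finsetSum _ fun i _ => hint' i]
    simp_rw [hibp]
    have e : ∑ i, ∑ j, Real.sin t * Real.cos t * D i j *
        ∫ ω, softmax i (Z t ω) * ((if j = i then 1 else 0) - softmax j (Z t ω)) ∂P
        = Real.sin t * Real.cos t * ∫ ω, ∑ i, ∑ j, D i j * (softmax i (Z t ω) *
          ((if j = i then 1 else 0) - softmax j (Z t ω))) ∂P := by
      rw [integral_finsetSum _ fun i _ => integrable_finsetSum _ fun j _ =>
        (hint i j).const_mul _, Finset.mul_sum]
      refine Finset.sum_congr rfl fun i _ => ?_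
      rw [integral_finsetSum _ fun j _ => (hint i j).const_mul _, Finset.mul_sum]
      refine Finset.sum_congr rfl fun j _ => ?_
      rw [integral_const_mul]; ring
    rw [e]
    refine mul_nonneg (mul_nonneg (Real.sin_nonneg_of_nonneg_of_le_pi ht.1 ?_)
      (Real.cos_nonneg_of_neg_pi_div_two_le_of_le ?_ ht.2)) (integral_nonneg fun ω => ?_)
    · linarith [ht.2, Real.pi_pos]
    · linarith [ht.1, Real.pi_pos]
    · exact sum_sum_mul_softmax_nonneg (fun i => softmax_nonneg i _) (sum_softmax _) hD
  have hmono : MonotoneOn (fun t => ∫ ω, logSumExp (Z t ω) ∂P) (Icc 0 (π / 2)) := by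
    refine monotoneOn_of_hasDerivWithinAt_nonneg (convex_Icc _ _)
      (fun t _ => (hderiv t).continuousAt.continuousWithinAt)
      (fun t _ => (hderiv t).hasDerivWithinAt) fun t ht => hpos t (interior_subset ht)
  have := hmono (left_mem_Icc.2 (by positivity)) (right_mem_Icc.2 (by positivity))
    (by positivity : (0 : ℝ) ≤ π / 2)
  simpa [Z] using this

/-- **Sudakov–Fernique inequality** for finite centered Gaussian vectors. -/
theorem integral_iSup_le_of_increments_le [Nonempty ι] {Ω' : Type*} [MeasurableSpace Ω']
    {P' : Measure Ω'} {X : Ω → ι → ℝ} {Y : Ω' → ι → ℝ}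
    (hX : HasGaussianLaw X P) (hY : HasGaussianLaw Y P')
    (hX0 : ∀ i, ∫ ω, X ω i ∂P = 0) (hY0 : ∀ i, ∫ ω, Y ω i ∂P' = 0)
    (hinc : ∀ i j, Var[fun ω => X ω i - X ω j; P] ≤ Var[fun ω => Y ω i - Y ω j; P']) :
    ∫ ω, (⨆ i, X ω i) ∂P ≤ ∫ ω, (⨆ i, Y ω i) ∂P' := by
  have := hX.isProbabilityMeasure
  have := hY.isProbabilityMeasure
  have hlse : ∀ β : ℝ, 0 < β →
      ∫ ω, logSumExp (β • X ω) ∂P ≤ ∫ ω, logSumExp (β • Y ω) ∂P' := by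
    intro β hβ
    have hXβ := hX.fun_smul β
    have hYβ := hY.fun_smul β
    have mfst : (P.prod P').map Prod.fst = P := by simp
    have msnd : (P.prod P').map Prod.snd = P' := by simp
    have ifst : ∀ f : Ω → ℝ, AEStronglyMeasurable f P →
        ∫ z, f z.1 ∂(P.prod P') = ∫ ω, f ω ∂P := fun f hf => by
      conv_rhs => rw [← mfst]
      rw [integral_map measurable_fst.aemeasurable (by rwa [mfst])]
    have isnd : ∀ f : Ω' → ℝ, AEStronglyMeasurable f P' →
        ∫ z, f z.2 ∂(P.prod P') = ∫ ω, f ω ∂P' := fun f hf => by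
      conv_rhs => rw [← msnd]
      rw [integral_map measurable_snd.aemeasurable (by rwa [msnd])]
    have hX1 : HasGaussianLaw (fun z : Ω × Ω' => β • X z.1) (P.prod P') := by
      refine ⟨?_⟩
      have := hXβ.isGaussian_map
      rw [← mfst, AEMeasurable.map_map_of_aemeasurable (by rw [mfst]; exact hXβ.aemeasurable)
        measurable_fst.aemeasurable] at this
      exact this
    have hY1 : HasGaussianLaw (fun z : Ω × Ω' => β • Y z.2) (P.prod P') := by
      refine ⟨?_⟩
      have := hYβ.isGaussian_map
      rw [← msnd, AEMeasurable.map_map_of_aemeasurable (by rw [msnd]; exact hYβ.aemeasurable)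
        measurable_snd.aemeasurable] at this
      exact this
    have key := integral_logSumExp_le_of_indepFun hX1 hY1
      (indepFun_prod₀ hXβ.aemeasurable hYβ.aemeasurable)
      (fun i => by
        rw [ifst (fun ω => (β • X ω) i) (hXβ.eval i).integrable.1]
        simp [integral_const_mul, hX0])
      (fun i => by
        rw [isnd (fun ω => (β • Y ω) i) (hYβ.eval i).integrable.1]
        simp [integral_const_mul, hY0])
      (fun i j => by
        have v1 : Var[fun z : Ω × Ω' => (β • X z.1) i - (β • X z.1) j; P.prod P']
            = β ^ 2 * Var[fun ω => X ω i - X ω j; P] := by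
          rw [← variance_const_mul]
          conv_rhs => rw [← mfst]
          rw [variance_map (by
            rw [mfst]; exact ((hX.eval i).aemeasurable.sub (hX.eval j).aemeasurable).const_mul _)
            measurable_fst.aemeasurable]
          congr 1; ext z; simp; ring
        have v2 : Var[fun z : Ω × Ω' => (β • Y z.2) i - (β • Y z.2) j; P.prod P']
            = β ^ 2 * Var[fun ω => Y ω i - Y ω j; P'] := by
          rw [← variance_const_mul]
          conv_rhs => rw [← msnd]
          rw [variance_map (by
            rw [msnd]; exact ((hY.eval i).aemeasurable.sub (hY.eval j).aemeasurable).const_mul _)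
            measurable_snd.aemeasurable]
          congr 1; ext z; simp; ring
        rw [v1, v2]
        exact mul_le_mul_of_nonneg_left (hinc i j) (sq_nonneg _))
    rwa [ifst (fun ω => logSumExp (β • X ω)) hXβ.integrable_logSumExp.1,
      isnd (fun ω => logSumExp (β • Y ω)) hYβ.integrable_logSumExp.1] at key
  have hbd : ∀ β : ℝ, 0 < β → ∫ ω, (⨆ i, X ω i) ∂P
      ≤ ∫ ω, (⨆ i, Y ω i) ∂P' + Real.log (Fintype.card ι) / β := by
    intro β hβ
    have h1 : β * ∫ ω, (⨆ i, X ω i) ∂P ≤ ∫ ω, logSumExp (β • X ω) ∂P := by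
      rw [← integral_const_mul]
      refine integral_mono (hX.integrable_iSup.const_mul _) (hX.fun_smul β).integrable_logSumExp
        fun ω => ?_
      dsimp only
      rw [Real.mul_iSup_of_nonneg hβ.le]
      exact ciSup_le fun i => le_logSumExp (β • X ω) i
    have h2 : ∫ ω, logSumExp (β • Y ω) ∂P'
        ≤ β * ∫ ω, (⨆ i, Y ω i) ∂P' + Real.log (Fintype.card ι) := by
      calc ∫ ω, logSumExp (β • Y ω) ∂P'
          ≤ ∫ ω, (β * (⨆ i, Y ω i) + Real.log (Fintype.card ι)) ∂P' := by
            refine integral_mono (hY.fun_smul β).integrable_logSumExp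
              ((hY.integrable_iSup.const_mul _).add (integrable_const _)) fun ω => ?_
            exact logSumExp_le fun i => mul_le_mul_of_nonneg_left
              (le_ciSup (Finite.bddAbove_range _) i) hβ.le
        _ = _ := by
            rw [integral_add (hY.integrable_iSup.const_mul _) (integrable_const _),
              integral_const_mul]
            simp
    rw [← sub_le_iff_le_add', le_div_iff₀ hβ]
    linarith [hlse β hβ]
  have hlim : Tendsto (fun β : ℝ => ∫ ω, (⨆ i, Y ω i) ∂P' + Real.log (Fintype.card ι) / β) atTop
      (𝓝 (∫ ω, (⨆ i, Y ω i) ∂P' + 0)) :=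
    tendsto_const_nhds.add (tendsto_const_nhds.div_atTop tendsto_id)
  rw [add_zero] at hlim
  exact ge_of_tendsto hlim (eventually_gt_atTop 0 |>.mono hbd)

end SudakovFernique

section GaussianProcess

variable {Ω : Type} [MeasurableSpace Ω] {μ : Measure Ω} {X : ℝ → Ω → ℝ} {S : Set ℝ}

theorem IsCenteredGaussianOn.exists_map_eq (h : IsCenteredGaussianOn μ X S) {ι : Type*} [Fintype ι]
    (c ts : ι → ℝ) (hts : ∀ i, ts i ∈ S) :
    ∃ v : NNReal, μ.map (fun ω => ∑ i, c i * X (ts i) ω) = gaussianReal 0 v := by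
  let e := Fintype.equivFin ι
  obtain ⟨v, hv⟩ := h.2 _ (c ∘ e.symm) (ts ∘ e.symm) (fun i => hts _)
  refine ⟨v, ?_⟩
  rw [← hv]
  congr 1
  ext ω
  exact (e.symm.sum_comp fun i => c i * X (ts i) ω).symm

theorem IsCenteredGaussianOn.hasGaussianLaw (h : IsCenteredGaussianOn μ X S) {ι : Type*} [Fintype ι]
    (ts : ι → ℝ) (hts : ∀ i, ts i ∈ S) : HasGaussianLaw (fun ω i => X (ts i) ω) μ := by
  classical
  have hm : Measurable fun ω i => X (ts i) ω := measurable_pi_lambda _ fun i => h.1 _ (hts i)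
  refine ⟨isGaussian_of_map_eq_gaussianReal fun L => ?_⟩
  obtain ⟨v, hv⟩ := h.exists_map_eq (fun i => L (Pi.single i 1)) ts hts
  refine ⟨0, v, ?_⟩
  rw [Measure.map_map (by fun_prop) hm, ← hv]
  congr 1
  ext ω
  simp only [Function.comp_apply]
  conv_lhs => rw [pi_eq_sum_univ' (fun i => X (ts i) ω)]
  simp [map_sum, mul_comm]

theorem IsCenteredGaussianOn.exists_map_sub_eq (h : IsCenteredGaussianOn μ X S) {s t : ℝ}
    (hs : s ∈ S) (ht : t ∈ S) :
    ∃ v : NNReal, HasLaw (fun ω => X t ω - X s ω) (gaussianReal 0 v) μ := by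
  obtain ⟨v, hv⟩ := h.2 2 ![1, -1] ![t, s] (by simp [Fin.forall_fin_two, hs, ht])
  refine ⟨v, ((h.1 t ht).sub (h.1 s hs)).aemeasurable, ?_⟩
  rw [← hv]
  simp [Fin.sum_univ_two, sub_eq_add_neg]

theorem IsCenteredGaussianOn.exists_hasLaw (h : IsCenteredGaussianOn μ X S) {t : ℝ}
    (ht : t ∈ S) : ∃ v : NNReal, HasLaw (X t) (gaussianReal 0 v) μ := by
  obtain ⟨v, hv⟩ := h.2 1 ![1] ![t] (by simp [ht])
  refine ⟨v, (h.1 t ht).aemeasurable, ?_⟩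
  rw [← hv]
  simp

theorem hasLaw_gaussianReal_integral_eq_zero {Y : Ω → ℝ} {v : NNReal}
    (h : HasLaw Y (gaussianReal 0 v) μ) : ∫ ω, Y ω ∂μ = 0 := by
  rw [h.integral_eq]; exact integral_id_gaussianReal

theorem hasLaw_gaussianReal_integral_sq {Y : Ω → ℝ} {v : NNReal}
    (h : HasLaw Y (gaussianReal 0 v) μ) : ∫ ω, Y ω ^ 2 ∂μ = v := by
  have h1 : Var[Y; μ] = v := by rw [h.variance_eq]; exact variance_id_gaussianReal
  rw [← h1, variance_eq_integral h.aemeasurable, hasLaw_gaussianReal_integral_eq_zero h]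
  simp

theorem hasLaw_gaussianReal_integral_pow_four {Y : Ω → ℝ} {v : NNReal}
    (h : HasLaw Y (gaussianReal 0 v) μ) :
    Integrable (fun ω => Y ω ^ 4) μ ∧
      ∫ ω, Y ω ^ 4 ∂μ = v ^ 2 * ∫ x, x ^ 4 ∂gaussianReal 0 1 := by
  have hm : gaussianReal 0 v = (gaussianReal 0 1).map (√(v : ℝ) * ·) := by
    rw [gaussianReal_map_const_mul]
    congr 1
    · simp
    · ext; simp
  have hs : AEStronglyMeasurable (fun x : ℝ => x ^ 4) (μ.map Y) := by fun_prop
  constructor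
  · have : Integrable (fun x : ℝ => x ^ 4) (μ.map Y) := by
      rw [h.map_eq]
      have := (memLp_id_gaussianReal (μ := 0) (v := v) 4).integrable_norm_pow (p := 4) (by simp)
      simpa [Real.norm_eq_abs, Even.pow_abs (by decide : Even 4)] using this
    exact this.comp_aemeasurable h.aemeasurable
  · rw [← integral_map (f := fun x : ℝ => x ^ 4) h.aemeasurable hs, h.map_eq, hm,
      integral_map (by fun_prop) (by fun_prop), ← integral_const_mul]
    congr 1
    ext x
    rw [mul_pow, show √(v : ℝ) ^ 4 = (√(v : ℝ) ^ 2) ^ 2 by ring, Real.sq_sqrt v.coe_nonneg]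

theorem integrable_of_monotone_of_tendsto {f : ℕ → Ω → ℝ} {F : Ω → ℝ} {M : ℝ}
    (hf : ∀ n, Integrable (f n) μ) (hmono : ∀ᵐ ω ∂μ, Monotone fun n => f n ω)
    (hlim : ∀ᵐ ω ∂μ, Tendsto (fun n => f n ω) atTop (𝓝 (F ω))) (hM : ∀ n, ∫ ω, f n ω ∂μ ≤ M) :
    Integrable F μ := by
  have hFm : AEStronglyMeasurable F μ :=
    aestronglyMeasurable_of_tendsto_ae atTop (fun n => (hf n).1) hlim
  suffices Integrable (fun ω => F ω - f 0 ω) μ by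
    exact (this.add (hf 0)).congr (ae_of_all _ fun ω => sub_add_cancel _ _)
  refine ⟨hFm.sub (hf 0).1, ?_⟩
  have hlim' := lintegral_tendsto_of_tendsto_of_monotone (μ := μ)
    (f := fun n ω => ENNReal.ofReal (f n ω - f 0 ω)) (F := fun ω => ENNReal.ofReal (F ω - f 0 ω))
    (fun n => ((hf n).1.aemeasurable.sub (hf 0).1.aemeasurable).ennreal_ofReal)
    (by filter_upwards [hmono] with ω hω i j hij
        exact ENNReal.ofReal_le_ofReal (sub_le_sub_right (hω hij) _))
    (by filter_upwards [hlim] with ω hω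
        exact (ENNReal.continuous_ofReal.tendsto _).comp (hω.sub_const _))
  have hb : ∫⁻ ω, ENNReal.ofReal (F ω - f 0 ω) ∂μ ≤ ENNReal.ofReal (M - ∫ ω, f 0 ω ∂μ) := by
    refine le_of_tendsto' hlim' fun n => ?_
    have hint : Integrable (fun ω => f n ω - f 0 ω) μ := (hf n).sub (hf 0)
    rw [← ofReal_integral_eq_lintegral_ofReal hint, integral_sub (hf n) (hf 0)]
    · exact ENNReal.ofReal_le_ofReal (sub_le_sub_right (hM n) _)
    · filter_upwards [hmono] with ω hω
      exact sub_nonneg.2 (hω (Nat.zero_le n))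
  rw [hasFiniteIntegral_iff_ofReal]
  · exact hb.trans_lt ENNReal.ofReal_lt_top
  · filter_upwards [hmono, hlim] with ω h1 h2
    exact sub_nonneg.2 (h1.ge_of_tendsto h2 0)

end GaussianProcess

section DyadicMax

/-- The maximum of `f` over the dyadic grid `{i / 2 ^ n : 0 ≤ i ≤ 2 ^ n}` of the unit interval. -/
def dyadicMax (f : ℝ → ℝ) (n : ℕ) : ℝ := ⨆ i : Fin (2 ^ n + 1), f ((i : ℕ) / 2 ^ n)

variable {f : ℝ → ℝ} {n : ℕ}

theorem dyadic_mem_Icc {i n : ℕ} (hi : i ≤ 2 ^ n) : (i : ℝ) / 2 ^ n ∈ Icc (0 : ℝ) 1 := by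
  refine ⟨by positivity, ?_⟩
  rw [div_le_one (by positivity)]
  exact_mod_cast hi

theorem le_dyadicMax {i : ℕ} (hi : i ≤ 2 ^ n) : f (i / 2 ^ n) ≤ dyadicMax f n :=
  le_ciSup (f := fun i : Fin (2 ^ n + 1) => f ((i : ℕ) / 2 ^ n)) (finite_range _).bddAbove
    ⟨i, Nat.lt_succ_of_le hi⟩

theorem dyadicMax_le {M : ℝ} (h : ∀ i ≤ 2 ^ n, f ((i : ℕ) / 2 ^ n) ≤ M) : dyadicMax f n ≤ M :=
  ciSup_le fun i => h i (Nat.le_of_lt_succ i.2)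

theorem two_mul_div_two_pow_succ (i n : ℕ) :
    ((2 * i : ℕ) : ℝ) / 2 ^ (n + 1) = i / 2 ^ n := by
  push_cast
  rw [pow_succ]
  field_simp

theorem monotone_dyadicMax : Monotone (dyadicMax f) := by
  refine monotone_nat_of_le_succ fun n => dyadicMax_le fun i hi => ?_
  rw [← two_mul_div_two_pow_succ]
  exact le_dyadicMax (by rw [pow_succ]; lia)

theorem dyadicMax_le_iSup (hf : ContinuousOn f (Icc 0 1)) :
    dyadicMax f n ≤ ⨆ t : Icc (0 : ℝ) 1, f t := by
  have hb : BddAbove (range fun t : Icc (0 : ℝ) 1 => f t) := by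
    have := (isCompact_Icc.image_of_continuousOn hf).bddAbove
    rwa [image_eq_range] at this
  exact dyadicMax_le fun i hi => le_ciSup hb ⟨_, dyadic_mem_Icc hi⟩

theorem tendsto_dyadicMax (hf : ContinuousOn f (Icc 0 1)) :
    Tendsto (dyadicMax f) atTop (𝓝 (⨆ t : Icc (0 : ℝ) 1, f t)) := by
  obtain ⟨t, ht, hmax⟩ := isCompact_Icc.exists_isMaxOn (nonempty_Icc.2 zero_le_one) hf
  have hsup : ⨆ t : Icc (0 : ℝ) 1, f t = f t :=
    le_antisymm (ciSup_le fun s => hmax s.2)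
      (le_ciSup (f := fun t : Icc (0 : ℝ) 1 => f t)
        ⟨f t, by rintro _ ⟨s, rfl⟩; exact hmax s.2⟩ ⟨t, ht⟩)
  have hle : ∀ n : ℕ, ⌊t * 2 ^ n⌋₊ ≤ 2 ^ n := fun n => by
    refine Nat.floor_le_of_le ?_
    push_cast
    exact mul_le_of_le_one_left (by positivity) ht.2
  have hpt : Tendsto (fun n : ℕ => (⌊t * 2 ^ n⌋₊ : ℝ) / 2 ^ n) atTop (𝓝 t) :=
    (tendsto_nat_floor_mul_div_atTop ht.1).comp (tendsto_pow_atTop_atTop_of_one_lt one_lt_two)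
  have hft : Tendsto (fun n : ℕ => f (⌊t * 2 ^ n⌋₊ / 2 ^ n)) atTop (𝓝 (f t)) :=
    (hf t ht).tendsto.comp (tendsto_nhdsWithin_iff.2
      ⟨hpt, Eventually.of_forall fun n => dyadic_mem_Icc (hle n)⟩)
  rw [hsup]
  refine tendsto_of_tendsto_of_tendsto_of_le_of_le hft tendsto_const_nhds
    (fun n => le_dyadicMax (hle n)) fun n => ?_
  rw [← hsup]
  exact dyadicMax_le_iSup hf

theorem le_add_pow_four_div {ε : ℝ} (hε : 0 < ε) (d : ℝ) : d ≤ ε + d ^ 4 / ε ^ 3 := by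
  rcases le_total d ε with h | h
  · have : 0 ≤ d ^ 4 / ε ^ 3 := by positivity
    linarith
  · have : d ≤ d ^ 4 / ε ^ 3 := by
      rw [le_div_iff₀ (by positivity), show d ^ 4 = d * d ^ 3 by ring]
      have := hε.trans_le h
      gcongr
    linarith

theorem dyadicMax_succ_le {ε : ℝ} (hε : 0 < ε) :
    dyadicMax f (n + 1) ≤ dyadicMax f n + (ε + (∑ i ∈ Finset.range (2 ^ n),
      (f ((2 * i + 1 : ℕ) / 2 ^ (n + 1)) - f ((2 * i : ℕ) / 2 ^ (n + 1))) ^ 4) / ε ^ 3) := by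
  refine dyadicMax_le fun j hj => ?_
  rcases Nat.even_or_odd' j with ⟨i, rfl | rfl⟩
  · rw [two_mul_div_two_pow_succ]
    have h1 := le_dyadicMax (f := f) (n := n) (i := i) (by rw [pow_succ] at hj; lia)
    have h2 : 0 ≤ ε + (∑ i ∈ Finset.range (2 ^ n),
      (f ((2 * i + 1 : ℕ) / 2 ^ (n + 1)) - f ((2 * i : ℕ) / 2 ^ (n + 1))) ^ 4) / ε ^ 3 := by
      positivity
    linarith
  · have hi : i < 2 ^ n := by rw [pow_succ] at hj; lia
    have h1 := le_dyadicMax (f := f) (n := n) hi.le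
    rw [← two_mul_div_two_pow_succ] at h1
    have h2 := le_add_pow_four_div hε
      (f ((2 * i + 1 : ℕ) / 2 ^ (n + 1)) - f ((2 * i : ℕ) / 2 ^ (n + 1)))
    have h3 := Finset.single_le_sum (f := fun i : ℕ =>
      (f ((2 * i + 1 : ℕ) / 2 ^ (n + 1)) - f ((2 * i : ℕ) / 2 ^ (n + 1))) ^ 4)
      (fun i _ => by positivity) (Finset.mem_range.2 hi)
    have h4 := div_le_div_of_nonneg_right h3 (pow_nonneg hε.le 3)
    linarith

end DyadicMax

section Comparison

variable {Ω : Type} [MeasurableSpace Ω] {μ : Measure Ω} {X W : ℝ → Ω → ℝ}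

theorem IsCenteredGaussianOn.integrable_dyadicMax (h : IsCenteredGaussianOn μ X (Icc 0 1)) (n : ℕ) :
    Integrable (fun ω => dyadicMax (fun t => X t ω) n) μ :=
  (h.hasGaussianLaw (fun i : Fin (2 ^ n + 1) => ((i : ℕ) : ℝ) / 2 ^ n)
    fun i => dyadic_mem_Icc (Nat.le_of_lt_succ i.2)).integrable_iSup

theorem IsCenteredGaussianOn.integral_eq_zero {S : Set ℝ} (h : IsCenteredGaussianOn μ X S) {t : ℝ}
    (ht : t ∈ S) : ∫ ω, X t ω ∂μ = 0 :=
  hasLaw_gaussianReal_integral_eq_zero (h.exists_hasLaw ht).choose_spec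

theorem IsCenteredGaussianOn.variance_sub {S : Set ℝ} (h : IsCenteredGaussianOn μ X S) {s t : ℝ}
    (hs : s ∈ S) (ht : t ∈ S) :
    Var[fun ω => X t ω - X s ω; μ] = ∫ ω, (X t ω - X s ω) ^ 2 ∂μ := by
  obtain ⟨v, hv⟩ := h.exists_map_sub_eq hs ht
  rw [hasLaw_gaussianReal_integral_sq hv, hv.variance_eq]
  exact variance_id_gaussianReal

theorem IsCenteredGaussianOn.integral_sq_sub_of_covariance
    (h : IsCenteredGaussianOn μ W (Icc 0 1))
    (hcov : ∀ s ∈ Icc (0:ℝ) 1, ∀ t ∈ Icc (0:ℝ) 1, ∫ ω, W s ω * W t ω ∂μ = min s t)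
    {s t : ℝ} (hs : s ∈ Icc (0:ℝ) 1) (ht : t ∈ Icc (0:ℝ) 1) :
    ∫ ω, (W t ω - W s ω) ^ 2 ∂μ = |t - s| := by
  have hL : ∀ u ∈ Icc (0:ℝ) 1, MemLp (W u) 2 μ := fun u hu => by
    obtain ⟨v, hv⟩ := h.exists_hasLaw hu
    have := memLp_id_gaussianReal (μ := 0) (v := v) 2
    rw [← hv.map_eq] at this
    exact (memLp_map_measure_iff (by fun_prop) hv.aemeasurable).1 this
  have hi : ∀ u ∈ Icc (0:ℝ) 1, ∀ w ∈ Icc (0:ℝ) 1, Integrable (fun ω => W u ω * W w ω) μ :=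
    fun u hu w hw => (hL u hu).integrable_mul (hL w hw)
  have : ∀ ω, (W t ω - W s ω) ^ 2 = W t ω * W t ω - 2 * (W s ω * W t ω) + W s ω * W s ω :=
    fun ω => by ring
  simp_rw [this]
  have hd : Integrable (fun ω => W t ω * W t ω - 2 * (W s ω * W t ω)) μ :=
    (hi t ht t ht).sub ((hi s hs t ht).const_mul 2)
  rw [integral_add hd (hi s hs s hs),
    integral_sub (hi t ht t ht) ((hi s hs t ht).const_mul 2), integral_const_mul,
    hcov t ht t ht, hcov s hs t ht, hcov s hs s hs]
  rcases le_total s t with hst | hst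
  · rw [abs_of_nonneg (sub_nonneg.2 hst)]; simp [hst]; ring
  · rw [abs_of_nonpos (sub_nonpos.2 hst)]; simp [hst]; ring

theorem integral_dyadicMax_le_of_covariance
    (h : IsCenteredGaussianOn μ W (Icc 0 1))
    (hcov : ∀ s ∈ Icc (0:ℝ) 1, ∀ t ∈ Icc (0:ℝ) 1, ∫ ω, W s ω * W t ω ∂μ = min s t) :
    ∃ M, ∀ n, ∫ ω, dyadicMax (fun t => W t ω) n ∂μ ≤ M := by
  set K := ∫ x, x ^ 4 ∂gaussianReal 0 1 with hK
  have hK0 : 0 ≤ K := integral_nonneg fun x => by positivity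
  have hstep : ∀ n, ∫ ω, dyadicMax (fun t => W t ω) (n + 1) ∂μ ≤
      ∫ ω, dyadicMax (fun t => W t ω) n ∂μ + (1 + K) * (7 / 8) ^ n := fun n => by
    have := (h.hasGaussianLaw (fun i : Fin 1 => 0) (by simp)).isProbabilityMeasure
    have hε : (0 : ℝ) < (7 / 8) ^ n := by positivity
    have hmom : ∀ i ∈ Finset.range (2 ^ n),
        Integrable (fun ω => (W ((2 * i + 1 : ℕ) / 2 ^ (n + 1)) ω -
          W ((2 * i : ℕ) / 2 ^ (n + 1)) ω) ^ 4) μ ∧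
        ∫ ω, (W ((2 * i + 1 : ℕ) / 2 ^ (n + 1)) ω - W ((2 * i : ℕ) / 2 ^ (n + 1)) ω) ^ 4 ∂μ
          = ((1 / 2 ^ (n + 1)) ^ 2) * K := fun i hi => by
      rw [Finset.mem_range] at hi
      have hs : ((2 * i : ℕ) : ℝ) / 2 ^ (n + 1) ∈ Icc (0 : ℝ) 1 :=
        dyadic_mem_Icc (by rw [pow_succ]; lia)
      have ht : ((2 * i + 1 : ℕ) : ℝ) / 2 ^ (n + 1) ∈ Icc (0 : ℝ) 1 :=
        dyadic_mem_Icc (by rw [pow_succ]; lia)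
      obtain ⟨v, hv⟩ := h.exists_map_sub_eq hs ht
      have hv' : (v : ℝ) = 1 / 2 ^ (n + 1) := by
        rw [← hasLaw_gaussianReal_integral_sq hv, h.integral_sq_sub_of_covariance hcov hs ht,
          ← sub_div, abs_of_nonneg (by push_cast; ring_nf; positivity)]
        push_cast
        ring
      have := hasLaw_gaussianReal_integral_pow_four hv
      rwa [hv'] at this
    have hsum := integrable_finsetSum (Finset.range (2 ^ n)) fun i hi => (hmom i hi).1
    have hrest : Integrable (fun ω => (7 / 8 : ℝ) ^ n + (∑ i ∈ Finset.range (2 ^ n),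
        (W ((2 * i + 1 : ℕ) / 2 ^ (n + 1)) ω - W ((2 * i : ℕ) / 2 ^ (n + 1)) ω) ^ 4) /
        ((7 / 8) ^ n) ^ 3) μ :=
      (integrable_const _).add (hsum.div_const _)
    refine (integral_mono (h.integrable_dyadicMax (n + 1)) ((h.integrable_dyadicMax n).add hrest)
      fun ω => dyadicMax_succ_le (f := fun t => W t ω) hε).trans ?_
    simp only [Pi.add_apply]
    rw [integral_add (h.integrable_dyadicMax n) hrest, integral_add (integrable_const _)
      (hsum.div_const _), integral_const, integral_div,
      integral_finsetSum _ fun i hi => (hmom i hi).1,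
      Finset.sum_congr rfl fun i hi => (hmom i hi).2]
    simp only [probReal_univ, one_smul, Finset.sum_const, Finset.card_range, nsmul_eq_mul,
      Nat.cast_pow, Nat.cast_ofNat]
    gcongr
    rw [add_mul, one_mul]
    gcongr
    rw [div_le_iff₀ (by positivity)]
    have hle : (1 / 2 : ℝ) ^ n ≤ ((7 / 8 : ℝ) ^ 4) ^ n := by gcongr; norm_num
    have h2 : (2 : ℝ) ^ n * ((1 / 2 ^ (n + 1)) ^ 2 * K) = K * ((1 / 2) ^ n / 4) := by
      rw [one_div_pow (2 : ℝ) n, pow_succ (2 : ℝ) n]; field_simp; ring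
    have h3 : K * (7 / 8 : ℝ) ^ n * ((7 / 8) ^ n) ^ 3 = K * ((7 / 8 : ℝ) ^ 4) ^ n := by
      rw [← pow_mul, ← pow_mul, mul_assoc, ← pow_add]; ring_nf
    rw [h2, h3]
    gcongr
    have : (0 : ℝ) ≤ (1 / 2) ^ n := by positivity
    linarith
  refine ⟨∫ ω, dyadicMax (fun t => W t ω) 0 ∂μ + (1 + K) * 8, fun n => ?_⟩
  have hind : ∀ n, ∫ ω, dyadicMax (fun t => W t ω) n ∂μ ≤
      ∫ ω, dyadicMax (fun t => W t ω) 0 ∂μ + (1 + K) * (8 * (1 - (7 / 8) ^ n)) := fun n => by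
    induction n with
    | zero => simp
    | succ n ih =>
      refine (hstep n).trans ?_
      rw [pow_succ]
      linarith
  refine (hind n).trans ?_
  have : (0 : ℝ) ≤ (7 / 8) ^ n := by positivity
  gcongr
  linarith

theorem integral_dyadicMax_le_mul_integral_dyadicMax {Ω' : Type} [MeasurableSpace Ω']
    {μ' : Measure Ω'} {W : ℝ → Ω' → ℝ} {C : ℝ} (hC : 0 ≤ C)
    (hX : IsCenteredGaussianOn μ X (Icc 0 1)) (hW : IsCenteredGaussianOn μ' W (Icc 0 1))
    (hinc : ∀ s ∈ Icc (0:ℝ) 1, ∀ t ∈ Icc (0:ℝ) 1,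
      ∫ ω, (X t ω - X s ω) ^ 2 ∂μ ≤ C ^ 2 * ∫ ω, (W t ω - W s ω) ^ 2 ∂μ') (n : ℕ) :
    ∫ ω, dyadicMax (fun t => X t ω) n ∂μ ≤ C * ∫ ω, dyadicMax (fun t => W t ω) n ∂μ' := by
  have hmem : ∀ i : Fin (2 ^ n + 1), ((i : ℕ) : ℝ) / 2 ^ n ∈ Icc (0 : ℝ) 1 :=
    fun i => dyadic_mem_Icc (Nat.le_of_lt_succ i.2)
  have key := integral_iSup_le_of_increments_le
    (hX.hasGaussianLaw (fun i : Fin (2 ^ n + 1) => ((i : ℕ) : ℝ) / 2 ^ n) hmem)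
    ((hW.hasGaussianLaw (fun i : Fin (2 ^ n + 1) => ((i : ℕ) : ℝ) / 2 ^ n) hmem).smul C)
    (fun i => hX.integral_eq_zero (hmem i))
    (fun i => by simp [integral_const_mul, hW.integral_eq_zero (hmem i)])
    (fun i j => by
      simp only [Pi.smul_apply, smul_eq_mul, ← mul_sub]
      rw [variance_const_mul, hX.variance_sub (hmem j) (hmem i), hW.variance_sub (hmem j) (hmem i)]
      exact hinc _ (hmem j) _ (hmem i))
  rw [← integral_const_mul]
  refine key.trans_eq (integral_congr_ae (ae_of_all _ fun ω => ?_))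
  simp only [Pi.smul_apply, smul_eq_mul, dyadicMax]
  exact (Real.mul_iSup_of_nonneg hC _).symm

end Comparison

/-- for `H ∈ [1/2, 1)`, comparison of the expected maximum with that of a
standard Brownian motion `W` (with covariance `E[W_s W_t] = min s t`). -/
theorem stmt2 {Ω : Type} [MeasurableSpace Ω] (μ : Measure Ω) [IsProbabilityMeasure μ]
    {Ω' : Type} [MeasurableSpace Ω'] (μ' : Measure Ω') [IsProbabilityMeasure μ']
    (X : ℝ → Ω → ℝ) (C H : ℝ) (hC : 0 < C) (hH₁ : (1:ℝ)/2 ≤ H) (hH₂ : H < 1)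
    (hgauss : IsCenteredGaussianOn μ X (Icc 0 1))
    (hcont : ∀ᵐ ω ∂μ, ContinuousOn (fun t => X t ω) (Icc 0 1))
    (hupp : ∀ s ∈ Icc (0:ℝ) 1, ∀ t ∈ Icc (0:ℝ) 1,
      l2norm μ (fun ω => X t ω - X s ω) ≤ C * |t - s| ^ H)
    (W : ℝ → Ω' → ℝ)
    (hWgauss : IsCenteredGaussianOn μ' W (Icc 0 1))
    (hWcont : ∀ᵐ ω ∂μ', ContinuousOn (fun t => W t ω) (Icc 0 1))
    (hWcov : ∀ s ∈ Icc (0:ℝ) 1, ∀ t ∈ Icc (0:ℝ) 1,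
      ∫ ω, W s ω * W t ω ∂μ' = min s t) :
    expMax μ X ≤ C * expMax μ' W := by
  have hX (n : ℕ) : ∫ ω, dyadicMax (fun t => X t ω) n ∂μ ≤
      C * ∫ ω, dyadicMax (fun t => W t ω) n ∂μ' := by
    refine integral_dyadicMax_le_mul_integral_dyadicMax hC.le hgauss hWgauss
      (fun s hs t ht => ?_) n
    rw [hWgauss.integral_sq_sub_of_covariance hWcov hs ht]
    have hst : |t - s| ≤ 1 := abs_sub_le_iff.2 ⟨by linarith [hs.1, ht.2], by linarith [hs.2, ht.1]⟩
    have hpow : |t - s| ^ H ≤ |t - s| ^ (1 / 2 : ℝ) :=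
      Real.rpow_le_rpow_of_exponent_ge_of_imp (abs_nonneg _) hst hH₁ (by intros; linarith)
    have h1 := (hupp s hs t ht).trans (mul_le_mul_of_nonneg_left hpow hC.le)
    rw [l2norm, Real.sqrt_le_iff, ← Real.sqrt_eq_rpow, mul_pow, Real.sq_sqrt (abs_nonneg _)] at h1
    exact h1.2
  have hWmono : ∀ᵐ ω ∂μ', Monotone fun n => dyadicMax (fun t => W t ω) n :=
    ae_of_all _ fun ω => monotone_dyadicMax
  have hWlim : ∀ᵐ ω ∂μ', Tendsto (fun n => dyadicMax (fun t => W t ω) n) atTop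
      (𝓝 (⨆ t : Icc (0:ℝ) 1, W t.1 ω)) := by
    filter_upwards [hWcont] with ω hω using tendsto_dyadicMax hω
  obtain ⟨M, hM⟩ := integral_dyadicMax_le_of_covariance hWgauss hWcov
  have hWint := integrable_of_monotone_of_tendsto hWgauss.integrable_dyadicMax hWmono hWlim hM
  have hWle (n : ℕ) : ∫ ω, dyadicMax (fun t => W t ω) n ∂μ' ≤ expMax μ' W :=
    integral_mono_ae (hWgauss.integrable_dyadicMax n) hWint
      (hWcont.mono fun ω hω => dyadicMax_le_iSup hω)
  by_cases hXint : Integrable (fun ω => ⨆ t : Icc (0:ℝ) 1, X t.1 ω) μ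
  · refine le_of_tendsto' (integral_tendsto_of_tendsto_of_monotone hgauss.integrable_dyadicMax hXint
      (ae_of_all _ fun ω => monotone_dyadicMax) ?_)
      fun n => (hX n).trans (mul_le_mul_of_nonneg_left (hWle n) hC.le)
    filter_upwards [hcont] with ω hω using tendsto_dyadicMax hω
  · rw [expMax, integral_undef hXint]
    refine mul_nonneg hC.le (le_trans ?_ (hWle 0))
    obtain ⟨v, hv⟩ := hWgauss.exists_hasLaw (t := 0) (by simp)
    rw [← hWgauss.integral_eq_zero (t := 0) (by simp)]
    refine integral_mono ?_ (hWgauss.integrable_dyadicMax 0) fun ω => ?_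
    · have := (memLp_id_gaussianReal (μ := 0) (v := v) 1).integrable (by simp)
      rw [← hv.map_eq] at this
      exact this.comp_aemeasurable hv.aemeasurable
    · simpa using le_dyadicMax (f := fun t => W t ω) (n := 0) (i := 0) (by simp)
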